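/- arXiv:0807.3519 — 3 statements merged into one kernel-verified Lean document; each statement's English description precedes it below -/
import Mathlib

section
/- Let l₁ < l₂ < ⋯ < l_k be the Lyndon words of length n on A. Then {l*(l₁), …, l*(l_k)} is a K-basis of the image under l* of the n-th homogeneous component of K⟨A⟩. -/
open MonoidAlgebra

/-- The word `w` viewed as a monomial in the free associative algebra `K⟨A⟩`. -/
noncomputable def word (K : Type*) [CommRing K] {A : Type*} (w : List A) :
    MonoidAlgebra K (FreeMonoid A) :=
  MonoidAlgebra.single (FreeMonoid.ofList w) 1

/-- The adjoint `l*` of the left-normed Lie bracketing, defined by the recursion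
`l*(ε) = 0`, `l*(a) = a`, `l*(aub) = l*(au)·b − l*(ub)·a`. -/
noncomputable def lstar (K : Type*) [CommRing K] {A : Type*} :
    List A → MonoidAlgebra K (FreeMonoid A)
  | [] => 0
  | [a] => word K [a]
  | a :: b :: r =>
      lstar K (a :: (b :: r).dropLast) * word K [(b :: r).getLast (by simp)]
        - lstar K (b :: r) * word K [a]
  termination_by w => w.length
  decreasing_by
    · simp [List.length_dropLast]
    · simp

/-- A Lyndon word: a nonempty word strictly (lexicographically) smaller than
all of its nonempty proper suffixes. -/
def IsLyndon {A : Type*} [LinearOrder A] (w : List A) : Prop :=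
  w ≠ [] ∧ ∀ i : ℕ, 0 < i → i < w.length → List.Lex (· < ·) w (w.drop i)


namespace LyndonAux

set_option linter.unusedSectionVars false
section Words
variable {A : Type*} [LinearOrder A]

theorem cons_lt_iff (a b : A) (u v : List A) : a :: u < b :: v ↔ a < b ∨ (a = b ∧ u < v) :=
  List.cons_lt_cons_iff

theorem cons_le_iff (a b : A) (u v : List A) : a :: u ≤ b :: v ↔ a < b ∨ (a = b ∧ u ≤ v) := by
  rw [le_iff_lt_or_eq, cons_lt_iff, le_iff_lt_or_eq, List.cons.injEq]
  tauto

theorem nil_le' (u : List A) : [] ≤ u := by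
  cases u with
  | nil => exact le_refl _
  | cons a u => exact le_of_lt List.Lex.nil

theorem le_nil' (u : List A) : u ≤ [] ↔ u = [] :=
  ⟨fun h => le_antisymm h (nil_le' _), fun h => h.le⟩

theorem append_lt_left (s : List A) (t u : List A) : s ++ t < s ++ u ↔ t < u := by
  induction s with
  | nil => rfl
  | cons a s ih => simp [ih]

theorem lt_split (s v : List A) (h : s < v) :
    (∃ t, t ≠ [] ∧ v = s ++ t) ∨ ∀ a b, s ++ a < v ++ b := by
  induction s generalizing v with
  | nil => exact Or.inl ⟨v, by rintro rfl; exact absurd h (lt_irrefl _), rfl⟩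
  | cons c s ih =>
    cases v with
    | nil => exact absurd (nil_le' (c :: s)) (not_le_of_gt h)
    | cons d v =>
      rw [cons_lt_iff] at h
      rcases h with h | ⟨rfl, h⟩
      · right; intro a b
        rw [List.cons_append, List.cons_append, cons_lt_iff]; exact Or.inl h
      · rcases ih v h with ⟨t, ht, rfl⟩ | h2
        · exact Or.inl ⟨t, ht, rfl⟩
        · right; intro a b
          rw [List.cons_append, List.cons_append, cons_lt_iff]; exact Or.inr ⟨rfl, h2 a b⟩

theorem append_lt_append_of_lt (s v a b : List A) (hl : s.length = v.length) (h : s < v) :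
    s ++ a < v ++ b := by
  rcases lt_split s v h with ⟨t, ht, rfl⟩ | h2
  · exfalso; apply ht; apply List.length_eq_zero_iff.1; simp at hl; simp [hl]
  · exact h2 a b

/-- Shuffles of two words. -/
def shuf {A : Type*} : List A → List A → List (List A)
  | [], v => [v]
  | a :: u, [] => [a :: u]
  | a :: u, b :: v => (shuf u (b :: v)).map (a :: ·) ++ (shuf (a :: u) v).map (b :: ·)
  termination_by u v => u.length + v.length

theorem shuf_nil_left (v : List A) : shuf [] v = [v] := by rw [shuf]
theorem shuf_nil_right (v : List A) : shuf v [] = [v] := by cases v <;> rw [shuf]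

theorem mem_shuf_nil_left (v y : List A) : y ∈ shuf [] v ↔ y = v := by simp [shuf_nil_left]
theorem mem_shuf_nil_right (v y : List A) : y ∈ shuf v [] ↔ y = v := by simp [shuf_nil_right]
theorem mem_shuf_cons (a b : A) (u v y : List A) : y ∈ shuf (a :: u) (b :: v) ↔
    (∃ z ∈ shuf u (b :: v), y = a :: z) ∨ (∃ z ∈ shuf (a :: u) v, y = b :: z) := by
  rw [shuf]; simp [eq_comm]

theorem cons_mem_shuf_left (a : A) (u v z : List A) (h : z ∈ shuf u v) :
    a :: z ∈ shuf (a :: u) v := by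
  cases v with
  | nil => rw [mem_shuf_nil_right] at *; rw [h]
  | cons b v => rw [mem_shuf_cons]; exact Or.inl ⟨z, h, rfl⟩

theorem cons_mem_shuf_right (a : A) (u v z : List A) (h : z ∈ shuf u v) :
    a :: z ∈ shuf u (a :: v) := by
  cases u with
  | nil => rw [mem_shuf_nil_left] at *; rw [h]
  | cons b u => rw [mem_shuf_cons]; exact Or.inr ⟨z, h, rfl⟩

theorem append_mem_shuf (u v : List A) : u ++ v ∈ shuf u v := by
  induction u with
  | nil => simp [shuf_nil_left]
  | cons a u ih => exact cons_mem_shuf_left a u v _ ih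

theorem append_mem_shuf' (u v : List A) : v ++ u ∈ shuf u v := by
  induction v with
  | nil => simp [shuf_nil_right]
  | cons a v ih => exact cons_mem_shuf_right a u v _ ih

theorem length_of_mem_shuf (N : ℕ) : ∀ (u v y : List A), u.length + v.length = N → y ∈ shuf u v →
    y.length = N := by
  induction N with
  | zero =>
    intro u v y h hy
    have h1 : u = [] := List.length_eq_zero_iff.1 (by omega)
    have h2 : v = [] := List.length_eq_zero_iff.1 (by omega)
    subst h1 h2
    rw [mem_shuf_nil_left] at hy; simp [hy]
  | succ N ih =>
    intro u v y h hy
    match u, v with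
    | [], v => rw [mem_shuf_nil_left] at hy; subst hy; simpa using h
    | a :: u, [] => rw [mem_shuf_nil_right] at hy; subst hy; simpa using h
    | a :: u, b :: v =>
      rw [mem_shuf_cons] at hy
      rcases hy with ⟨z, hz, rfl⟩ | ⟨z, hz, rfl⟩
      · have := ih _ _ z (by simp at h ⊢; omega) hz
        simp [this]
      · have := ih _ _ z (by simp at h ⊢; omega) hz
        simp [this]

/-- Exchange lemma. -/
theorem exchange (N : ℕ) : ∀ (p r q z : List A), p.length + r.length + q.length = N → q ≤ r →
    z ∈ shuf (p ++ r) q → ∃ y ∈ shuf r (p ++ q), z ≤ y := by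
  induction N with
  | zero =>
    intro p r q z h _ hz
    have h1 : p = [] := List.length_eq_zero_iff.1 (by omega)
    subst h1
    exact ⟨z, hz, le_refl _⟩
  | succ N ih =>
    intro p r q z h hqr hz
    match p, q with
    | [], q => exact ⟨z, hz, le_refl _⟩
    | c :: p, [] =>
      rw [mem_shuf_nil_right] at hz
      subst hz
      refine ⟨_, append_mem_shuf' _ _, by simp⟩
    | c :: p, d :: q =>
      rw [List.cons_append, mem_shuf_cons] at hz
      rcases hz with ⟨z, hz, rfl⟩ | ⟨z, hz, rfl⟩
      · obtain ⟨y, hy, hle⟩ := ih p r (d :: q) z (by simp at h ⊢; omega) hqr hz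
        exact ⟨c :: y, cons_mem_shuf_right c _ _ _ hy, List.cons_le_cons c hle⟩
      · match r with
        | [] => rw [le_nil'] at hqr; exact absurd hqr (by simp)
        | e :: r =>
          rw [cons_le_iff] at hqr
          rcases hqr with hlt | ⟨rfl, hle⟩
          · refine ⟨_, cons_mem_shuf_left e r (c :: p ++ d :: q) _ (append_mem_shuf _ _), ?_⟩
            rw [cons_le_iff]; exact Or.inl hlt
          · obtain ⟨y, hy, hle⟩ := ih (c :: p ++ [d]) r q z (by simp at h ⊢; omega) hle
              (by simpa using hz)
            exact ⟨d :: y, cons_mem_shuf_left d _ _ _ (by simpa using hy), List.cons_le_cons d hle⟩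

theorem shuf_le (u v : List A) (h : ∀ s, s ≠ [] → s <:+ u → v ≤ s) :
    ∀ y ∈ shuf u v, y ≤ u ++ v := by
  induction u with
  | nil => intro y hy; rw [mem_shuf_nil_left] at hy; simp [hy]
  | cons a u ih =>
    have ih' := ih (fun s hs hsu => h s hs (hsu.trans (List.suffix_cons a u)))
    intro y hy
    match v with
    | [] => rw [mem_shuf_nil_right] at hy; simp [hy]
    | b :: v =>
      have h0 := h (a :: u) (by simp) (List.suffix_refl _)
      rw [mem_shuf_cons] at hy
      rcases hy with ⟨z, hz, rfl⟩ | ⟨z, hz, rfl⟩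
      · exact List.cons_le_cons a (ih' z hz)
      · rw [cons_le_iff] at h0
        rcases h0 with hlt | ⟨rfl, hle⟩
        · rw [List.cons_append, cons_le_iff]; exact Or.inl hlt
        · obtain ⟨y, hy, hzy⟩ := exchange _ [b] u v z rfl hle hz
          exact List.cons_le_cons b (hzy.trans (ih' y hy))

/-- A non-Lyndon word is a factorisation into `u`, `v` whose shuffles are all `≤ uv`. -/
theorem nonLyndon_factor (x : List A) (hx : x ≠ []) (hL : ¬ IsLyndon x) :
    ∃ u v, u ≠ [] ∧ v ≠ [] ∧ x = u ++ v ∧ ∀ y ∈ shuf u v, y ≤ x := by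
  have hpos : 0 < x.length := List.length_pos_iff.2 hx
  obtain ⟨i, hi, hmin⟩ := Finset.exists_min_image (Finset.range x.length) (fun i => x.drop i)
    ⟨0, by simpa using hpos⟩
  simp only [Finset.mem_range] at hi hmin
  have hi0 : i ≠ 0 := by
    rintro rfl
    apply hL
    refine ⟨hx, fun j hj hjx => ?_⟩
    have := hmin j hjx
    rcases this.lt_or_eq with h | h
    · exact h
    · have := congrArg List.length h
      simp at this; omega
  refine ⟨x.take i, x.drop i, ?_, ?_, (List.take_append_drop i x).symm, ?_⟩
  · intro h; have := congrArg List.length h; rw [List.length_take, List.length_nil] at this; omega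
  · intro h; have := congrArg List.length h; simp at this; omega
  · intro y hy
    have := shuf_le (x.take i) (x.drop i) ?_ y hy
    · simpa using this
    · rintro s hs ⟨p, hp⟩
      by_contra hlt
      rw [not_le] at hlt
      have hxs : x = p ++ (s ++ x.drop i) := by
        rw [← List.append_assoc, hp, List.take_append_drop]
      have hslen : 0 < s.length := List.length_pos_iff.2 hs
      have hlen : x.length = p.length + (s.length + (x.length - i)) := by
        have := congrArg List.length hxs
        simpa using this
      have h1 : x.drop i ≤ s ++ x.drop i := by
        have := hmin p.length (by omega)
        have h2 : x.drop p.length = s ++ x.drop i := by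
          conv_lhs => rw [hxs]
          simp
        rwa [h2] at this
      rcases lt_split _ _ hlt with ⟨t, ht, hvt⟩ | h2
      · have htlen : 0 < t.length := List.length_pos_iff.2 ht
        have h3 : s ++ t ≤ s ++ x.drop i := hvt ▸ h1
        have h4 : t ≤ x.drop i := by
          by_contra h; rw [not_le] at h
          exact absurd h3 (not_le_of_gt ((append_lt_left s _ _).2 h))
        have hlv := congrArg List.length hvt
        simp at hlv
        have h5 : t = x.drop (i + s.length) := by
          rw [← List.drop_drop, hvt]; simp
        have h6 := hmin (i + s.length) (by omega)
        rw [← h5] at h6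
        have h7 := congrArg List.length (le_antisymm h4 h6)
        simp at h7; omega
      · have := h2 (x.drop i) []
        rw [List.append_nil] at this
        exact absurd h1 (not_le_of_gt this)

theorem lyndon_factor (x : List A) (hL : IsLyndon x) (h2 : 2 ≤ x.length) :
    ∃ u v, IsLyndon u ∧ IsLyndon v ∧ x = u ++ v ∧ u ++ v < v ++ u := by
  obtain ⟨i, hi, hmin⟩ := Finset.exists_min_image (Finset.Ico 1 x.length) (fun i => x.drop i)
    ⟨1, by simp; omega⟩
  simp only [Finset.mem_Ico] at hi hmin
  have hx := hL.2
  refine ⟨x.take i, x.drop i, ⟨?_, ?_⟩, ⟨?_, ?_⟩, (List.take_append_drop i x).symm, ?_⟩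
  · intro h; have := congrArg List.length h; rw [List.length_take, List.length_nil] at this; omega
  · intro j hj hji
    have hji' : j < i := by simp at hji; omega
    by_contra hnot
    have hle : (x.take i).drop j ≤ x.take i := not_lt.1 hnot
    have hlt : (x.take i).drop j < x.take i := by
      refine lt_of_le_of_ne hle fun h => ?_
      have := congrArg List.length h; simp at this; omega
    have hxj : x < (x.take i).drop j ++ x.drop i := by
      have h1 : x < x.drop j := hx j hj (by omega)
      have h3 : x.drop j = (x.take i).drop j ++ x.drop i := by
        conv_lhs => rw [← List.take_append_drop i x]
        rw [List.drop_append_of_le_length (by simp; omega)]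
      rwa [h3] at h1
    rcases lt_split _ _ hlt with ⟨t, ht, hut⟩ | h3
    · have htlen : 0 < t.length := List.length_pos_iff.2 ht
      have hxe : x = (x.take i).drop j ++ (t ++ x.drop i) := by
        rw [← List.append_assoc, ← hut, List.take_append_drop]
      have h4 : t ++ x.drop i < x.drop i := by
        rw [← append_lt_left ((x.take i).drop j), ← hxe]; exact hxj
      have hl : ((x.take i).drop j).length = i - j := by simp; omega
      have h5 : x.drop (i - j) = t ++ x.drop i := by
        conv_lhs => rw [hxe]
        rw [List.drop_append_of_le_length (by omega), List.drop_of_length_le (by omega)]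
        simp
      have h6 := hmin (i - j) (by omega)
      rw [h5] at h6
      exact absurd h4 (not_lt_of_ge h6)
    · have := h3 (x.drop i) (x.drop i)
      rw [List.take_append_drop] at this
      exact absurd hxj (not_lt_of_gt this)
  · intro h; have := congrArg List.length h; simp at this; omega
  · intro j hj hji
    simp at hji
    have := hmin (i + j) (by omega)
    rw [← List.drop_drop] at this
    refine lt_of_le_of_ne this fun h => ?_
    have := congrArg List.length h; simp at this; omega
  · rw [List.take_append_drop]
    have h1 : x < x.drop i := hx i (by omega) (by omega)
    refine lt_of_lt_of_le h1 ?_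
    have : x.drop i ++ [] ≤ x.drop i ++ x.take i := by
      by_contra h
      rw [not_le, append_lt_left] at h
      exact absurd h (not_lt_of_ge (nil_le' _))
    simpa using this

end Words

section Algebra
variable {K : Type*} [CommRing K] {A : Type*}

theorem word_mul (u v : List A) : word K u * word K v = word K (u ++ v) := by
  simp [word, MonoidAlgebra.single_mul_single, FreeMonoid.ofList_append]

theorem lstar_nil : lstar K ([] : List A) = 0 := by rw [lstar]
theorem lstar_single (a : A) : lstar K [a] = word K [a] := by rw [lstar]

theorem lstar_snoc (a : A) (u : List A) (b : A) : lstar K (a :: (u ++ [b])) =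
    lstar K (a :: u) * word K [b] - lstar K (u ++ [b]) * word K [a] := by
  cases u with
  | nil => simp [lstar]
  | cons c u => 
    rw [List.cons_append, lstar]
    simp
    rw [← List.cons_append, List.dropLast_concat]

/-- coefficient of a word, as a linear map -/
noncomputable def cf (w : List A) : MonoidAlgebra K (FreeMonoid A) →ₗ[K] K where
  toFun P := P.coeff (FreeMonoid.ofList w)
  map_add' _ _ := by simp
  map_smul' _ _ := by simp

theorem cf_apply (w : List A) (P : MonoidAlgebra K (FreeMonoid A)) :
    cf w P = P.coeff (FreeMonoid.ofList w) := rfl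

theorem cf_word [DecidableEq A] (u v : List A) : cf u (word K v) = if u = v then 1 else 0 := by
  classical
  simp [cf_apply, word, Finsupp.single_apply, eq_comm]

theorem cf_mul_word_snoc [DecidableEq A] (P : MonoidAlgebra K (FreeMonoid A)) (v : List A) (c d : A) :
    cf (v ++ [d]) (P * word K [c]) = if c = d then cf v P else 0 := by
  split_ifs with h
  · subst h
    simp only [cf_apply, word]
    rw [MonoidAlgebra.coeff_mul_single_eq_coeff_mul (FreeMonoid.ofList v), mul_one]
    intro m _
    rw [FreeMonoid.ofList_append, mul_left_inj]
  · apply MonoidAlgebra.coeff_mul_single_of_forall_mul_ne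
    intro m hm
    have : m.toList ++ [c] = v ++ [d] := hm
    simp at this
    exact h this.2

theorem cf_nil_mul_word (P : MonoidAlgebra K (FreeMonoid A)) (c : A) :
    cf [] (P * word K [c]) = 0 := by
  apply MonoidAlgebra.coeff_mul_single_of_forall_mul_ne
  intro m hm
  have : m.toList ++ [c] = [] := hm
  simp at this

theorem cf_word_mul_cons [DecidableEq A] (P : MonoidAlgebra K (FreeMonoid A)) (v : List A) (c d : A) :
    cf (d :: v) (word K [c] * P) = if c = d then cf v P else 0 := by
  split_ifs with h
  · subst h
    simp only [cf_apply, word]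
    rw [MonoidAlgebra.coeff_single_mul_eq_mul_coeff (FreeMonoid.ofList v), one_mul]
    intro m _
    rw [FreeMonoid.ofList_singleton, FreeMonoid.ofList_cons, mul_right_inj]
  · apply MonoidAlgebra.coeff_single_mul_of_forall_mul_ne
    intro m hm
    have : c :: m.toList = d :: v := hm
    simp at this
    exact h this.1

theorem cf_nil_word_mul (P : MonoidAlgebra K (FreeMonoid A)) (c : A) :
    cf [] (word K [c] * P) = 0 := by
  apply MonoidAlgebra.coeff_single_mul_of_forall_mul_ne
  intro m hm
  have : c :: m.toList = [] := hm
  simp at this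

/-- left-normed bracketing -/
noncomputable def lb (K : Type*) [CommRing K] {A : Type*} :
    List A → MonoidAlgebra K (FreeMonoid A)
  | [] => 0
  | a :: r => r.foldl (fun x c => x * word K [c] - word K [c] * x) (word K [a])

theorem lb_single (a : A) : lb K [a] = word K [a] := rfl

theorem lb_snoc (v : List A) (hv : v ≠ []) (c : A) :
    lb K (v ++ [c]) = lb K v * word K [c] - word K [c] * lb K v := by
  cases v with
  | nil => exact absurd rfl hv
  | cons a v => simp [lb]

theorem cf_nil_lb (v : List A) : cf [] (lb K v) = 0 := by
  classical
  induction v using List.reverseRecOn with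
  | nil => simp [lb]
  | append_singleton v c ih =>
    by_cases hv : v = []
    · subst hv; simp [lb, cf_word]
    · rw [lb_snoc v hv, map_sub, cf_nil_mul_word, cf_nil_word_mul, sub_zero]

theorem cf_lstar (N : ℕ) : ∀ (w v : List A), w.length = N →  cf v (lstar K w) = cf w (lb K v) := by
  classical
  induction N with
  | zero =>
    intro w v hw
    have : w = [] := List.length_eq_zero_iff.1 hw
    subst this
    rw [lstar_nil, map_zero, cf_nil_lb]
  | succ N ih =>
    intro w v hw
    match w with
    | [] => simp at hw
    | a :: w =>
      rcases List.eq_nil_or_concat' w with rfl | ⟨u, b, rfl⟩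
      · rw [lstar_single, cf_word]
        rcases List.eq_nil_or_concat' v with rfl | ⟨v, c, rfl⟩
        · simp [lb]
        · by_cases hv : v = []
          · subst hv
            simp [lb, cf_word, eq_comm]
          · rw [lb_snoc v hv, map_sub]
            have h1 := cf_mul_word_snoc (K := K) (lb K v) [] c a
            have h2 := cf_word_mul_cons (K := K) (lb K v) [] c a
            simp only [List.nil_append] at h1
            rw [h1, h2, if_neg]
            · simp
            · cases v with
              | nil => exact absurd rfl hv
              | cons x v => simp
      · rw [lstar_snoc, map_sub]
        rcases List.eq_nil_or_concat' v with rfl | ⟨v, c, rfl⟩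
        · rw [cf_nil_mul_word, cf_nil_mul_word]; simp [lb]
        · have e1 := ih (a :: u) v (by simp at hw ⊢; omega)
          have e2 := ih (u ++ [b]) v (by simp at hw ⊢; omega)
          rw [cf_mul_word_snoc, cf_mul_word_snoc, e1, e2]
          by_cases hv : v = []
          · subst hv
            simp [lb, cf_word]
          · rw [lb_snoc v hv, map_sub, cf_word_mul_cons, ← List.cons_append, cf_mul_word_snoc]
            simp only [eq_comm]

/-- The span of left-normed brackets. -/
noncomputable def LS (K : Type*) [CommRing K] (A : Type*) :
    Submodule K (MonoidAlgebra K (FreeMonoid A)) := Submodule.span K (Set.range (lb K))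

theorem lb_mem (v : List A) : lb K v ∈ LS K A := Submodule.subset_span ⟨v, rfl⟩

theorem LS_letter (c : A) (x : MonoidAlgebra K (FreeMonoid A)) (hx : x ∈ LS K A) :
    x * word K [c] - word K [c] * x ∈ LS K A := by
  induction hx using Submodule.span_induction with
  | mem x h =>
    obtain ⟨v, rfl⟩ := h
    by_cases hv : v = []
    · subst hv; simp [lb]
    · rw [← lb_snoc v hv]; exact lb_mem _
  | zero => simp
  | add x y _ _ hx hy =>
    convert add_mem hx hy using 1
    noncomm_ring
  | smul a x _ hx =>
    convert Submodule.smul_mem _ a hx using 1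
    rw [smul_sub, smul_mul_assoc, mul_smul_comm]

theorem LS_lb (v : List A) : ∀ (x : MonoidAlgebra K (FreeMonoid A)), x ∈ LS K A →
    x * lb K v - lb K v * x ∈ LS K A := by
  induction v using List.reverseRecOn with
  | nil => intro x _; simp [lb]
  | append_singleton v c ih =>
    intro x hx
    by_cases hv : v = []
    · subst hv; exact LS_letter c x hx
    · rw [lb_snoc v hv]
      have h1 := LS_letter c _ (ih x hx)
      have h2 := ih _ (LS_letter c x hx)
      convert sub_mem h1 h2 using 1
      noncomm_ring

theorem LS_bracket (x y : MonoidAlgebra K (FreeMonoid A)) (hx : x ∈ LS K A) (hy : y ∈ LS K A) :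
    x * y - y * x ∈ LS K A := by
  induction hy using Submodule.span_induction with
  | mem y h => obtain ⟨v, rfl⟩ := h; exact LS_lb v x hx
  | zero => simp
  | add y z _ _ hx hy =>
    convert add_mem hx hy using 1
    noncomm_ring
  | smul a y _ hx =>
    convert Submodule.smul_mem _ a hx using 1
    rw [smul_sub, smul_mul_assoc, mul_smul_comm]

/-- For a Lie element there is a functional computing its coefficients through `lstar`. -/
theorem exists_functional (P : MonoidAlgebra K (FreeMonoid A)) (hP : P ∈ LS K A) :
    ∃ φ : MonoidAlgebra K (FreeMonoid A) →ₗ[K] K, ∀ w, φ (lstar K w) = cf w P := by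
  induction hP using Submodule.span_induction with
  | mem y h => obtain ⟨v, rfl⟩ := h; exact ⟨cf v, fun w => cf_lstar _ w v rfl⟩
  | zero => exact ⟨0, by simp⟩
  | add y z _ _ hx hy =>
    obtain ⟨f, hf⟩ := hx
    obtain ⟨g, hg⟩ := hy
    exact ⟨f + g, fun w => by simp [hf, hg]⟩
  | smul a y _ hx =>
    obtain ⟨f, hf⟩ := hx
    exact ⟨a • f, fun w => by simp [hf]⟩

section Tri
variable [LinearOrder A]

/-- words of the same length which are greater -/
noncomputable def UU (K : Type*) [CommRing K] {A : Type*} [LinearOrder A] (w : List A) :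
    Submodule K (MonoidAlgebra K (FreeMonoid A)) :=
  Submodule.span K {P | ∃ x : List A, x.length = w.length ∧ w < x ∧ P = word K x}

theorem cf_UU (w x : List A) (hx : x ≤ w) (P : MonoidAlgebra K (FreeMonoid A)) (hP : P ∈ UU K w) :
    cf x P = 0 := by
  induction hP using Submodule.span_induction with
  | mem y h =>
    obtain ⟨v, _, hv, rfl⟩ := h
    rw [cf_word, if_neg]
    rintro rfl
    exact absurd hv (not_lt_of_ge hx)
  | zero => simp
  | add y z _ _ hx hy => simp [hx, hy]
  | smul a y _ hx => simp [hx]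

theorem UU_mul (u v : List A) (P Q : MonoidAlgebra K (FreeMonoid A)) (hP : P ∈ UU K u)
    (hQ : Q ∈ UU K v) : P * Q ∈ UU K (u ++ v) := by
  have := Submodule.mul_mem_mul hP hQ
  rw [UU, UU, Submodule.span_mul_span] at this
  refine Submodule.span_mono ?_ this
  rintro _ ⟨_, ⟨x, hx, hux, rfl⟩, _, ⟨y, hy, hvy, rfl⟩, rfl⟩
  exact ⟨x ++ y, by simp [hx, hy], append_lt_append_of_lt _ _ _ _ hx.symm hux, word_mul _ _⟩

theorem UU_mul_word (u v : List A) (P : MonoidAlgebra K (FreeMonoid A)) (hP : P ∈ UU K u) :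
    P * word K v ∈ UU K (u ++ v) := by
  have := Submodule.mul_mem_mul hP (Submodule.mem_span_singleton_self (R := K) (word K v))
  rw [UU, Submodule.span_mul_span] at this
  refine Submodule.span_mono ?_ this
  rintro _ ⟨_, ⟨x, hx, hux, rfl⟩, _, rfl, rfl⟩
  exact ⟨x ++ v, by simp [hx], append_lt_append_of_lt _ _ _ _ hx.symm hux, word_mul _ _⟩

theorem word_mul_UU (u v : List A) (P : MonoidAlgebra K (FreeMonoid A)) (hP : P ∈ UU K v) :
    word K u * P ∈ UU K (u ++ v) := by
  have := Submodule.mul_mem_mul (Submodule.mem_span_singleton_self (R := K) (word K u)) hP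
  rw [UU, Submodule.span_mul_span] at this
  refine Submodule.span_mono ?_ this
  rintro _ ⟨_, rfl, _, ⟨x, hx, hux, rfl⟩, rfl⟩
  exact ⟨u ++ x, by simp [hx], (append_lt_left _ _ _).2 hux, word_mul _ _⟩

theorem UU_mono (u v : List A) (h : u.length = v.length) (huv : u < v) : UU K v ≤ UU K u := by
  refine Submodule.span_mono ?_
  rintro _ ⟨x, hx, hux, rfl⟩
  exact ⟨x, by rw [hx, h], huv.trans hux, rfl⟩

theorem tri_mul (u v : List A) (P Q : MonoidAlgebra K (FreeMonoid A)) (hP : P - word K u ∈ UU K u)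
    (hQ : Q - word K v ∈ UU K v) : P * Q - word K (u ++ v) ∈ UU K (u ++ v) := by
  have h1 := UU_mul _ _ _ _ hP hQ
  have h2 := UU_mul_word u v _ hP
  have h3 := word_mul_UU u v _ hQ
  convert add_mem (add_mem h1 h2) h3 using 1
  rw [← word_mul]
  noncomm_ring

theorem exists_lyndon_lie (N : ℕ) : ∀ (w : List A), w.length ≤ N → IsLyndon w →
    ∃ P ∈ LS K A, P - word K w ∈ UU K w := by
  induction N with
  | zero =>
    intro w hw hL
    exact absurd (List.length_eq_zero_iff.1 (by omega)) hL.1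
  | succ N ih =>
    intro w hw hL
    by_cases h2 : 2 ≤ w.length
    · obtain ⟨u, v, hu, hv, rfl, hlt⟩ := lyndon_factor w hL h2
      have hu0 := List.length_pos_iff.2 hu.1
      have hv0 := List.length_pos_iff.2 hv.1
      rw [List.length_append] at hw
      obtain ⟨P, hP, hP'⟩ := ih u (by omega) hu
      obtain ⟨Q, hQ, hQ'⟩ := ih v (by omega) hv
      refine ⟨P * Q - Q * P, LS_bracket P Q hP hQ, ?_⟩
      have h1 := tri_mul u v P Q hP' hQ'
      have hlen : (u ++ v).length = (v ++ u).length := by simp [add_comm]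
      have h3 := UU_mono (K := K) _ _ hlen hlt (tri_mul v u Q P hQ' hP')
      have h4 : word K (v ++ u) ∈ UU K (u ++ v) := Submodule.subset_span ⟨_, hlen.symm, hlt, rfl⟩
      convert sub_mem (sub_mem h1 h3) h4 using 1
      abel
    · match w with
      | [] => exact absurd rfl hL.1
      | [a] => exact ⟨word K [a], lb_mem [a], by simp⟩
      | a :: b :: w => simp at h2

theorem exists_phi (w : List A) (hL : IsLyndon w) :
    ∃ φ : MonoidAlgebra K (FreeMonoid A) →ₗ[K] K, φ (lstar K w) = 1 ∧
      ∀ x, x < w → φ (lstar K x) = 0 := by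
  obtain ⟨P, hP, hP'⟩ := exists_lyndon_lie (K := K) _ w le_rfl hL
  obtain ⟨φ, hφ⟩ := exists_functional P hP
  have key : ∀ x, x ≤ w → cf x P = cf x (word K w) := by
    intro x hx
    have := cf_UU w x hx _ hP'
    rwa [map_sub, sub_eq_zero] at this
  refine ⟨φ, ?_, fun x hx => ?_⟩
  · rw [hφ, key w le_rfl, cf_word, if_pos rfl]
  · rw [hφ, key x hx.le, cf_word, if_neg hx.ne]

end Tri

/-- sum over shuffles -/
theorem shuf_sum_cons {M : Type*} [AddCommMonoid M] (f : List A → M) (a b : A) (u v : List A) :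
    ((shuf (a :: u) (b :: v)).map f).sum =
      ((shuf u (b :: v)).map (fun y => f (a :: y))).sum +
      ((shuf (a :: u) v).map (fun y => f (b :: y))).sum := by
  rw [shuf, List.map_append, List.sum_append, List.map_map, List.map_map]
  rfl

theorem shuf_nl (v : List A) : shuf [] v = [v] := by rw [shuf]
theorem shuf_nr (v : List A) : shuf v [] = [v] := by cases v <;> rw [shuf]

theorem shuf_sum_snoc {M : Type*} [AddCommMonoid M] (N : ℕ) : ∀ (f : List A → M) (c d : A)
    (u v : List A), u.length + v.length = N → 
    ((shuf (u ++ [c]) (v ++ [d])).map f).sum =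
      ((shuf u (v ++ [d])).map (fun y => f (y ++ [c]))).sum +
      ((shuf (u ++ [c]) v).map (fun y => f (y ++ [d]))).sum := by
  induction N with
  | zero =>
    intro f c d u v h
    have h1 : u = [] := List.length_eq_zero_iff.1 (by omega)
    have h2 : v = [] := List.length_eq_zero_iff.1 (by omega)
    subst h1 h2
    simp only [List.nil_append]
    rw [shuf_sum_cons]
    simp [shuf_nl, shuf_nr, add_comm]
  | succ N ih =>
    intro f c d u v h
    match u, v with
    | [], [] => simp at h
    | [], b :: v =>
      have := ih (fun y => f (b :: y)) c d [] v (by simp at h ⊢; omega)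
      simp only [List.nil_append, List.cons_append] at this ⊢
      rw [shuf_sum_cons, this, shuf_sum_cons]
      simp [shuf_nl]
      abel
    | a :: u, [] =>
      have := ih (fun y => f (a :: y)) c d u [] (by simp at h ⊢; omega)
      simp only [List.nil_append, List.cons_append] at this ⊢
      rw [shuf_sum_cons, this, shuf_sum_cons]
      simp [shuf_nr]
      abel
    | a :: u, b :: v =>
      have h1 := ih (fun y => f (a :: y)) c d u (b :: v) (by simp at h ⊢; omega)
      have h2 := ih (fun y => f (b :: y)) c d (a :: u) v (by simp at h ⊢; omega)
      simp only [List.cons_append] at h1 h2 ⊢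
      rw [shuf_sum_cons, h1, h2, shuf_sum_cons, shuf_sum_cons]
      simp only [List.cons_append]
      abel

/-- the part of `lstar` removing the last letter -/
noncomputable def Gp (K : Type*) [CommRing K] {A : Type*} (y : List A) :
    MonoidAlgebra K (FreeMonoid A) :=
  if h : y ≠ [] then lstar K y.dropLast * word K [y.getLast h] else 0

/-- the part of `lstar` removing the first letter -/
noncomputable def Hp (K : Type*) [CommRing K] {A : Type*} : List A →
    MonoidAlgebra K (FreeMonoid A)
  | [] => 0
  | a :: y => lstar K y * word K [a]

theorem Gp_snoc (y : List A) (c : A) : Gp K (y ++ [c]) = lstar K y * word K [c] := by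
  simp [Gp]

theorem lstar_eq (y : List A) (h : 2 ≤ y.length) : lstar K y = Gp K y - Hp K y := by
  match y with
  | [] => simp at h
  | a :: y =>
    rcases List.eq_nil_or_concat' y with rfl | ⟨u, b, rfl⟩
    · simp at h
    · rw [lstar_snoc, ← List.cons_append, Gp_snoc]; rfl

theorem sum_map_sub' {M : Type*} [AddCommGroup M] (l : List (List A)) (f g : List A → M) :
    (l.map (fun y => f y - g y)).sum = (l.map f).sum - (l.map g).sum := by
  induction l with
  | nil => simp
  | cons a l ih => simp only [List.map_cons, List.sum_cons, ih]; abel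

end Algebra

section Final

theorem ends_aux {K : Type*} [CommRing K] {A : Type*} (S : List A → MonoidAlgebra K (FreeMonoid A))
    (a c : A) (u u' : List A) (h : a :: u = u' ++ [c])
    (hS : ∀ x, x ≠ [] → x.length < (a :: u).length → S x = 0) :
    S u' * word K [c] = S u * word K [a] := by
  have hl := congrArg List.length h
  simp at hl
  by_cases hu : u = []
  · subst hu
    have : u' = [] := List.length_eq_zero_iff.1 (by simpa using hl.symm)
    subst this
    simp at h
    rw [h]
  · have hu' : u' ≠ [] := by
      rintro rfl
      exact hu (List.length_eq_zero_iff.1 (by simpa using hl))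
    rw [hS u hu (by simp), hS u' hu' (by simp; omega), zero_mul, zero_mul]

theorem shuf_lstar {K : Type*} [CommRing K] {A : Type*} [LinearOrder A] (N : ℕ) :
    ∀ u v : List A, u ≠ [] → v ≠ [] → u.length + v.length = N →
    ((shuf u v).map (lstar K)).sum = 0 := by
  induction N using Nat.strong_induction_on with
  | _ N ih =>
    intro u v hu hv hN
    have hlu := List.length_pos_iff.2 hu
    have hlv := List.length_pos_iff.2 hv
    have e : (shuf u v).map (lstar K) = (shuf u v).map (fun y => Gp K y - Hp K y) := by
      apply List.map_congr_left
      intro y hy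
      apply lstar_eq
      have := length_of_mem_shuf _ u v y hN hy
      omega
    rw [e, sum_map_sub', sub_eq_zero]
    obtain ⟨a, u1, hu1⟩ := List.exists_cons_of_ne_nil hu
    obtain ⟨b, v1, hv1⟩ := List.exists_cons_of_ne_nil hv
    obtain ⟨u2, c, hu2⟩ := (List.eq_nil_or_concat' u).resolve_left hu
    obtain ⟨v2, d, hv2⟩ := (List.eq_nil_or_concat' v).resolve_left hv
    have hG : ((shuf u v).map (Gp K)).sum =
        ((shuf u2 v).map (lstar K)).sum * word K [c] +
          ((shuf u v2).map (lstar K)).sum * word K [d] := by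
      rw [hu2, hv2, shuf_sum_snoc _ _ _ _ _ _ rfl, ← List.sum_map_mul_right,
        ← List.sum_map_mul_right]
      simp only [Gp_snoc]
    have hH : ((shuf u v).map (Hp K)).sum =
        ((shuf u1 v).map (lstar K)).sum * word K [a] +
          ((shuf u v1).map (lstar K)).sum * word K [b] := by
      rw [hu1, hv1, shuf_sum_cons, ← List.sum_map_mul_right, ← List.sum_map_mul_right]
      rfl
    rw [hG, hH]
    congr 1
    · refine ends_aux (fun x => ((shuf x v).map (lstar K)).sum) a c u1 u2 (by rw [← hu1, hu2]) ?_
      intro x hx hl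
      rw [← hu1] at hl
      exact ih _ (by omega) x v hx hv rfl
    · refine ends_aux (fun x => ((shuf u x).map (lstar K)).sum) b d v1 v2 (by rw [← hv1, hv2]) ?_
      intro x hx hl
      rw [← hv1] at hl
      exact ih _ (by omega) u x hu hx rfl

/-- Elements having a nonzero integer multiple in a subgroup. -/
def rootClosure {M : Type*} [AddCommGroup M] (S : Submodule ℤ M) : Submodule ℤ M where
  carrier := {z | ∃ m : ℤ, m ≠ 0 ∧ m • z ∈ S}
  add_mem' := by
    rintro x y ⟨m, hm, hx⟩ ⟨k, hk, hy⟩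
    refine ⟨m * k, mul_ne_zero hm hk, ?_⟩
    rw [smul_add]
    refine add_mem ?_ ?_
    · rw [mul_comm, mul_smul]; exact S.smul_mem _ hx
    · rw [mul_smul]; exact S.smul_mem _ hy
  zero_mem' := ⟨1, one_ne_zero, by simp⟩
  smul_mem' := by
    rintro c x ⟨m, hm, hx⟩
    refine ⟨m, hm, ?_⟩
    rw [smul_comm]; exact S.smul_mem _ hx

theorem mem_rootClosure {M : Type*} [AddCommGroup M] (S : Submodule ℤ M) (z : M) :
    z ∈ rootClosure S ↔ ∃ m : ℤ, m ≠ 0 ∧ m • z ∈ S := Iff.rfl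

theorem le_rootClosure {M : Type*} [AddCommGroup M] (S : Submodule ℤ M) : S ≤ rootClosure S :=
  fun z hz => ⟨1, one_ne_zero, by simpa using hz⟩

theorem list_sum_split {M : Type*} [AddCommGroup M] {α : Type*} (T : Submodule ℤ M) (x : α)
    (f : α → M) (l : List α) (h : ∀ y ∈ l, y = x ∨ f y ∈ T) :
    ∃ k : ℕ, (x ∈ l → k ≠ 0) ∧ (l.map f).sum - (k : ℤ) • f x ∈ T := by
  induction l with
  | nil => exact ⟨0, by simp, by simp⟩
  | cons y l ih =>
    obtain ⟨k, hk, hm⟩ := ih (fun y hy => h y (List.mem_cons_of_mem _ hy))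
    by_cases hyx : y = x
    · subst hyx
      refine ⟨k + 1, by simp, ?_⟩
      convert hm using 1
      push_cast
      rw [List.map_cons, List.sum_cons, add_smul, one_smul]
      abel
    · have hy := (h y List.mem_cons_self).resolve_left hyx
      refine ⟨k, fun hx => hk ?_, ?_⟩
      · rcases List.mem_cons.1 hx with h | h
        · exact absurd h.symm hyx
        · exact h
      · convert add_mem hy hm using 1
        rw [List.map_cons, List.sum_cons]
        abel

/-- The index type of Lyndon words of length `n`. -/
abbrev LW (A : Type*) [LinearOrder A] (n : ℕ) := {w : List A // w.length = n ∧ IsLyndon w}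

theorem lstar_root {A : Type*} [Fintype A] [LinearOrder A] (n : ℕ) (x : {w : List A // w.length = n}) :
    lstar ℤ x.val ∈ rootClosure
      (Submodule.span ℤ (Set.range fun w : LW A n => lstar ℤ w.val)) := by
  have : Finite {w : List A // w.length = n} := List.finite_length_eq A n
  induction x using WellFoundedLT.induction with
  | _ x ih =>
    by_cases hL : IsLyndon x.val
    · exact le_rootClosure _ (Submodule.subset_span ⟨⟨x.val, x.2, hL⟩, rfl⟩)
    by_cases hx : x.val = []
    · rw [hx, lstar_nil]; exact zero_mem _
    obtain ⟨u, v, hu, hv, huv, hle⟩ := nonLyndon_factor x.val hx hL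
    have hlen : u.length + v.length = n := by rw [← List.length_append, ← huv, x.2]
    have h0 := shuf_lstar (K := ℤ) _ u v hu hv hlen
    obtain ⟨k, hk, hm⟩ := list_sum_split (rootClosure
      (Submodule.span ℤ (Set.range fun w : LW A n => lstar ℤ w.val))) x.val (lstar ℤ) (shuf u v) (by
        intro y hy
        by_cases hyx : y = x.val
        · exact Or.inl hyx
        · right
          exact ih ⟨y, length_of_mem_shuf _ u v y hlen hy⟩ (lt_of_le_of_ne (hle y hy) (fun h => hyx (congrArg Subtype.val h))))
    rw [h0, zero_sub, neg_mem_iff, mem_rootClosure] at hm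
    have hk0 := hk (huv ▸ append_mem_shuf u v)
    obtain ⟨m, hm0, hm⟩ := hm
    exact ⟨m * k, mul_ne_zero hm0 (by exact_mod_cast hk0), by rw [mul_smul]; exact hm⟩

section Dual
variable {K V ι : Type*} [CommRing K] [AddCommGroup V] [Module K V] [Fintype ι] [LinearOrder ι]
  (e : ι → V) (φ : ι → V →ₗ[K] K) (h1 : ∀ i, φ i (e i) = 1) (h0 : ∀ i j, j < i → φ i (e j) = 0)

theorem dual_unit (h1 : ∀ i, φ i (e i) = 1) (h0 : ∀ i j, j < i → φ i (e j) = 0) :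
    IsUnit (Matrix.of fun i j => φ i (e j)).det := by
  rw [Matrix.det_of_isUpperTriangular]
  · simp [h1]
  · intro i j hij
    exact h0 i j hij

theorem dual_apply (c : ι → K) (i : ι) :
    φ i (∑ j, c j • e j) = ((Matrix.of fun i j => φ i (e j)).mulVec c) i := by
  simp [Matrix.mulVec, dotProduct, mul_comm]

theorem dual_zero (h1 : ∀ i, φ i (e i) = 1) (h0 : ∀ i j, j < i → φ i (e j) = 0) (c : ι → K)
    (h : ∀ i, φ i (∑ j, c j • e j) = 0) : c = 0 := by
  have hu := dual_unit e φ h1 h0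
  have : (Matrix.of fun i j => φ i (e j)).mulVec c = 0 := by
    ext i; rw [← dual_apply]; exact h i
  have h2 := congrArg (Matrix.of fun i j => φ i (e j))⁻¹.mulVec this
  rwa [Matrix.mulVec_mulVec, Matrix.nonsing_inv_mul _ hu, Matrix.one_mulVec,
    Matrix.mulVec_zero] at h2

theorem dual_linInd (h1 : ∀ i, φ i (e i) = 1) (h0 : ∀ i j, j < i → φ i (e j) = 0) :
    LinearIndependent K e := by
  rw [Fintype.linearIndependent_iff]
  intro c hc i
  have := dual_zero e φ h1 h0 c (fun i => by rw [hc, map_zero])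
  rw [this]; rfl

theorem dual_solve (h1 : ∀ i, φ i (e i) = 1) (h0 : ∀ i j, j < i → φ i (e j) = 0) (v : V) :
    ∃ c : ι → K, ∀ i, φ i (v - ∑ j, c j • e j) = 0 := by
  have hu := dual_unit e φ h1 h0
  refine ⟨(Matrix.of fun i j => φ i (e j))⁻¹.mulVec (fun i => φ i v), fun i => ?_⟩
  rw [map_sub, dual_apply, Matrix.mulVec_mulVec, Matrix.mul_nonsing_inv _ hu, Matrix.one_mulVec,
    sub_self]

end Dual

theorem exists_phis (K : Type*) [CommRing K] {A : Type*} [LinearOrder A] (n : ℕ) :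
    ∃ φ : LW A n → MonoidAlgebra K (FreeMonoid A) →ₗ[K] K,
      (∀ i, φ i (lstar K i.val) = 1) ∧ ∀ i j, j < i → φ i (lstar K j.val) = 0 := by
  choose φ h1 h0 using fun i : LW A n => exists_phi (K := K) i.val i.2.2
  exact ⟨φ, h1, fun i j hij => h0 i j.val hij⟩

theorem lstar_mem_int {A : Type*} [Fintype A] [LinearOrder A] (n : ℕ) (x : List A)
    (hx : x.length = n) :
    ∃ c : LW A n →₀ ℤ, lstar ℤ x = c.sum (fun w m => m • lstar ℤ w.val) := by
  have : Finite {w : List A // w.length = n} := List.finite_length_eq A n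
  have : Finite (LW A n) := Finite.of_injective
    (fun w : LW A n => (⟨w.val, w.2.1⟩ : {w : List A // w.length = n}))
    (fun a b h => Subtype.ext (by simpa using h))
  have := Fintype.ofFinite (LW A n)
  obtain ⟨φ, h1, h0⟩ := exists_phis ℤ (A := A) n
  let e : LW A n → MonoidAlgebra ℤ (FreeMonoid A) := fun w => lstar ℤ w.val
  obtain ⟨c, hc⟩ := dual_solve e φ h1 h0 (lstar ℤ x)
  have hr : lstar ℤ x - ∑ j, c j • e j ∈ rootClosure
      (Submodule.span ℤ (Set.range e)) := by
    refine sub_mem (lstar_root n ⟨x, hx⟩) (le_rootClosure _ ?_)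
    exact sum_mem fun j _ => Submodule.smul_mem _ _ (Submodule.subset_span ⟨j, rfl⟩)
  obtain ⟨m, hm, hmem⟩ := hr
  obtain ⟨d, hd⟩ := (Submodule.mem_span_range_iff_exists_fun ℤ).1 hmem
  have hd0 := dual_zero e φ h1 h0 d (fun i => by rw [hd, map_smul, hc, smul_zero])
  rw [hd0] at hd
  have hz : lstar ℤ x - ∑ j, c j • e j = 0 := by
    have h2 : m • (lstar ℤ x - ∑ j, c j • e j) = 0 := by rw [← hd]; simp
    ext w
    have h3 := congrArg (fun P => MonoidAlgebra.coeff P w) h2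
    simp only [MonoidAlgebra.coeff_smul, Finsupp.smul_apply, smul_eq_mul] at h3
    have := (mul_eq_zero.1 h3).resolve_left hm
    exact this
  refine ⟨Finsupp.equivFunOnFinite.symm c, ?_⟩
  rw [Finsupp.sum_fintype _ _ (by simp), sub_eq_zero.1 hz]
  rfl

theorem map_lstar (K : Type*) [CommRing K] {A : Type*} (N : ℕ) : ∀ w : List A, w.length = N →
    MonoidAlgebra.mapRingHom (FreeMonoid A) (Int.castRingHom K) (lstar ℤ w) = lstar K w := by
  induction N with
  | zero =>
    intro w hw
    rw [List.length_eq_zero_iff.1 hw, lstar_nil, lstar_nil, map_zero]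
  | succ N ih =>
    intro w hw
    have hword : ∀ a : A, MonoidAlgebra.mapRingHom (FreeMonoid A) (Int.castRingHom K)
        (word ℤ [a]) = word K [a] := by intro a; simp [word]
    match w with
    | [] => simp at hw
    | a :: w =>
      rcases List.eq_nil_or_concat' w with rfl | ⟨u, b, rfl⟩
      · rw [lstar_single, lstar_single, hword]
      · rw [lstar_snoc, lstar_snoc, map_sub, map_mul, map_mul, hword, hword,
          ih _ (by simp at hw ⊢; omega), ih _ (by simp at hw ⊢; omega)]

end Final

end LyndonAux

/-- the images under `l*` of the Lyndon words of length `n` form a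
`K`-basis of the image under `l*` of the `n`-th homogeneous component of `K⟨A⟩`. -/
theorem lstar_lyndon_basis {K : Type*} [CommRing K] {A : Type*} [Fintype A] [LinearOrder A]
    (n : ℕ) :
    LinearIndependent K
      (fun w : {w : List A // w.length = n ∧ IsLyndon w} => lstar K w.val) ∧
    Submodule.span K
        (Set.range fun w : {w : List A // w.length = n ∧ IsLyndon w} => lstar K w.val) =
      Submodule.span K {P | ∃ w : List A, w.length = n ∧ P = lstar K w} := by
  classical
  have : Finite {w : List A // w.length = n} := List.finite_length_eq A n
  have : Finite (LyndonAux.LW A n) := Finite.of_injective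
    (fun w : LyndonAux.LW A n => (⟨w.val, w.2.1⟩ : {w : List A // w.length = n}))
    (fun a b h => Subtype.ext (by simpa using h))
  have := Fintype.ofFinite (LyndonAux.LW A n)
  constructor
  · obtain ⟨φ, h1, h0⟩ := LyndonAux.exists_phis K (A := A) n
    exact LyndonAux.dual_linInd _ φ h1 h0
  · apply le_antisymm
    · apply Submodule.span_mono
      rintro _ ⟨w, rfl⟩
      exact ⟨w.val, w.2.1, rfl⟩
    · rw [Submodule.span_le]
      rintro _ ⟨w, hw, rfl⟩
      obtain ⟨c, hc⟩ := LyndonAux.lstar_mem_int n w hw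
      rw [← LyndonAux.map_lstar K _ w rfl, hc, Finsupp.sum, map_sum]
      refine sum_mem fun i _ => ?_
      rw [map_zsmul, LyndonAux.map_lstar K _ i.val rfl]
      exact zsmul_mem (Submodule.subset_span (Set.mem_range_self i)) _
end

section
/- For nonnegative integers k, l not both zero and letters a ≠ b, one has l*(a^k b a^l) = (−1)^k · C(k+l, k) · (b a^{k+l} − a b a^{k+l−1}), where C denotes the binomial coefficient. -/
open MonoidAlgebra

theorem word_mul_aux (K : Type*) [CommRing K] {A : Type*} (u v : List A) :
    word K u * word K v = word K (u ++ v) := by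
  simp [word, MonoidAlgebra.single_mul_single]

theorem lstar_step_aux (K : Type*) [CommRing K] {A : Type*} (x y : A) (u : List A) :
    lstar K (x :: (u ++ [y])) =
      lstar K (x :: u) * word K [y] - lstar K (u ++ [y]) * word K [x] := by
  cases u with
  | nil => simp [lstar]
  | cons c r =>
    rw [List.cons_append, lstar]
    have h1 : (c :: (r ++ [y])).dropLast = c :: r := by
      rw [← List.cons_append, List.dropLast_concat]
    have h2 : (c :: (r ++ [y])).getLast (by simp) = y := by
      simp
    rw [h1, h2]

theorem lstar_replicate_aux (K : Type*) [CommRing K] {A : Type*} (a : A) (n : ℕ) :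
    lstar K (List.replicate (n + 2) a) = 0 := by
  have h : List.replicate (n + 2) a = a :: (List.replicate n a ++ [a]) := by
    rw [← List.replicate_succ', ← List.replicate_succ]
  rw [h, lstar_step_aux, ← List.replicate_succ', ← List.replicate_succ, sub_self]

theorem lstar_main_aux (K : Type*) [CommRing K] {A : Type*} (a b : A) (n : ℕ) :
    ∀ k l : ℕ, k + l = n + 1 →
    lstar K (List.replicate k a ++ b :: List.replicate l a) =
      ((-1 : K) ^ k * ((n + 1).choose k : K)) •
        (word K (b :: List.replicate (n + 1) a)
          - word K (a :: b :: List.replicate n a)) := by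
  induction n with
  | zero =>
    intro k l h
    rcases k with _ | k
    · obtain rfl : l = 1 := by omega
      simp [lstar, word_mul_aux]
    · obtain rfl : k = 0 := by omega
      obtain rfl : l = 0 := by omega
      simp [lstar, word_mul_aux]
  | succ n ih =>
    intro k l h
    have hP : (word K (b :: List.replicate (n + 1) a)
          - word K (a :: b :: List.replicate n a)) * word K [a] =
        word K (b :: List.replicate (n + 1 + 1) a)
          - word K (a :: b :: List.replicate (n + 1) a) := by
      rw [sub_mul, word_mul_aux, word_mul_aux, List.replicate_succ' (n := n + 1)]
      simp only [List.cons_append, ← List.replicate_succ']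
    rcases k with _ | k
    · obtain rfl : l = n + 2 := by omega
      have e : List.replicate 0 a ++ b :: List.replicate (n + 2) a
          = b :: (List.replicate (n + 1) a ++ [a]) := by
        rw [← List.replicate_succ']; rfl
      have h0 := ih 0 (n + 1) (by omega)
      simp only [List.replicate_zero, List.nil_append] at h0
      rw [e, lstar_step_aux, ← List.replicate_succ', lstar_replicate_aux, h0,
        smul_mul_assoc, hP]
      simp
    · rcases l with _ | l
      · obtain rfl : k = n + 1 := by omega
        have e : List.replicate (n + 1 + 1) a ++ b :: List.replicate 0 a
            = a :: (List.replicate (n + 1) a ++ [b]) := by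
          simp [List.replicate_succ]
        have h0 := ih (n + 1) 0 (by omega)
        simp only [List.replicate_zero] at h0
        rw [e, lstar_step_aux, ← List.replicate_succ, lstar_replicate_aux, h0,
          smul_mul_assoc, hP]
        simp [pow_succ]
      · have e : List.replicate (k + 1) a ++ b :: List.replicate (l + 1) a
            = a :: ((List.replicate k a ++ b :: List.replicate l a) ++ [a]) := by
          rw [List.replicate_succ, List.replicate_succ' (n := l)]
          simp
        have e2 : (List.replicate k a ++ b :: List.replicate l a) ++ [a]
            = List.replicate k a ++ b :: List.replicate (l + 1) a := by
          rw [List.replicate_succ' (n := l)]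
          simp
        have h1 := ih (k + 1) l (by omega)
        have h2 := ih k (l + 1) (by omega)
        rw [List.replicate_succ, List.cons_append] at h1
        rw [e, lstar_step_aux, e2, h1, h2, smul_mul_assoc, smul_mul_assoc, hP, ← sub_smul]
        congr 1
        rw [Nat.choose_succ_succ (n + 1) k]
        push_cast
        ring

/-- `l*(a^k b a^l) = (−1)^k C(k+l,k) (b a^{k+l} − a b a^{k+l−1})`. -/
theorem lstar_pow_letter {K : Type*} [CommRing K] {A : Type*} [Fintype A]
    (a b : A) (hab : a ≠ b) (k l : ℕ) (hkl : ¬(k = 0 ∧ l = 0)) :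
    lstar K (List.replicate k a ++ b :: List.replicate l a) =
      ((-1 : K) ^ k * ((k + l).choose k : K)) •
        (word K (b :: List.replicate (k + l) a)
          - word K (a :: b :: List.replicate (k + l - 1) a)) := by
  obtain ⟨n, hn⟩ : ∃ n, k + l = n + 1 := ⟨k + l - 1, by omega⟩
  have h := lstar_main_aux K a b n k l hn
  rw [h, hn, Nat.add_sub_cancel]
end

section
/- Over the free Lie ring (K = ℤ), a word w satisfies l*(w) = 0 if and only if w is either a power a^n of a single letter with n ≥ 2, or a palindrome of even length. -/
open MonoidAlgebra

theorem lstar_cons_concat {A : Type*} (a b : A) (u : List A) :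
    lstar ℤ (a :: (u ++ [b])) =
      lstar ℤ (a :: u) * word ℤ [b] - lstar ℤ (u ++ [b]) * word ℤ [a] := by
  cases u with
  | nil => simp [lstar]
  | cons c r =>
    rw [List.cons_append, lstar]
    have h1 : (c :: (r ++ [b])).dropLast = c :: r := by
      rw [← List.cons_append, List.dropLast_concat]
    have h2 : (c :: (r ++ [b])).getLast (by simp) = b := by simp
    rw [h1, h2]

/-- coefficient of the reversal of `s` in `lstar w`. -/
noncomputable def cf {A : Type*} (w s : List A) : ℤ :=
  (lstar ℤ w).coeff (FreeMonoid.ofList s.reverse)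

theorem coeff_mul_word {A : Type*} [DecidableEq A] (x : MonoidAlgebra ℤ (FreeMonoid A))
    (b c : A) (v : List A) :
    (x * word ℤ [b]).coeff (FreeMonoid.ofList (v ++ [c])) =
      if c = b then x.coeff (FreeMonoid.ofList v) else 0 := by
  unfold word
  split_ifs with h
  · subst h
    rw [MonoidAlgebra.coeff_mul_single_eq_coeff_mul (FreeMonoid.ofList v)]
    · simp
    · intro m' _
      rw [FreeMonoid.ofList_append]
      exact mul_left_inj _
  · apply MonoidAlgebra.coeff_mul_single_of_forall_mul_ne
    intro d hd
    have h2 : d.toList ++ [b] = v ++ [c] := hd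
    have := List.append_inj_right' h2 rfl
    simp at this
    exact h this.symm

theorem coeff_mul_word_nil {A : Type*} (x : MonoidAlgebra ℤ (FreeMonoid A))
    (b : A) :
    (x * word ℤ [b]).coeff (FreeMonoid.ofList []) = 0 := by
  unfold word
  apply MonoidAlgebra.coeff_mul_single_of_forall_mul_ne
  intro d hd
  have h2 : d.toList ++ [b] = [] := hd
  simp at h2

theorem cf_nil {A : Type*} (s : List A) : cf [] s = 0 := by simp [cf, lstar]

theorem cf_single {A : Type*} [DecidableEq A] (a : A) (s : List A) :
    cf [a] s = if s = [a] then 1 else 0 := by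
  have : FreeMonoid.ofList [a] = FreeMonoid.ofList s.reverse ↔ s = [a] := by
    rw [EmbeddingLike.apply_eq_iff_eq, eq_comm, List.reverse_eq_iff]; simp
  simp only [cf, lstar, word, MonoidAlgebra.coeff_single]
  classical
  rw [Finsupp.single_apply]
  simp only [this]

theorem cf_step {A : Type*} [DecidableEq A] (a b c : A) (u s : List A) :
    cf (a :: (u ++ [b])) (c :: s) =
      (if c = b then cf (a :: u) s else 0) - (if c = a then cf (u ++ [b]) s else 0) := by
  simp only [cf, lstar_cons_concat, MonoidAlgebra.coeff_sub, Finsupp.sub_apply, List.reverse_cons,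
    coeff_mul_word]

theorem cf_right_nil {A : Type*} (w : List A) : cf w [] = 0 := by
  classical
  induction w using List.bidirectionalRec with
  | nil => exact cf_nil _
  | singleton a => simp [cf_single]
  | cons_append a u b =>
    simp only [cf, lstar_cons_concat, MonoidAlgebra.coeff_sub, Finsupp.sub_apply, List.reverse_nil,
      coeff_mul_word_nil, sub_zero]

theorem lstar_eq_zero_iff_cf {A : Type*} (w : List A) : lstar ℤ w = 0 ↔ ∀ s, cf w s = 0 := by
  constructor
  · intro h s; simp [cf, h]
  · intro h
    ext m
    have := h m.toList.reverse
    simpa [cf] using this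

theorem cf_reverse {A : Type*} (w s : List A) :
    cf w.reverse s = (-1) ^ (w.length + 1) * cf w s := by
  classical
  induction hn : w.length generalizing w s with
  | zero => 
    have : w = [] := List.length_eq_zero_iff.mp hn
    subst this; simp [cf_nil]
  | succ n ih =>
    induction w using List.bidirectionalRec with
    | nil => simp at hn
    | singleton a => simp at hn; subst hn; simp
    | cons_append a u b =>
      cases s with
      | nil => simp [cf_right_nil]
      | cons c s =>
        have e : (a :: (u ++ [b])).reverse = b :: (u.reverse ++ [a]) := by simp
        have e1 := ih (a :: u) s (by simpa using hn)
        have e2 := ih (u ++ [b]) s (by simpa using hn)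
        simp only [List.reverse_cons, List.reverse_append, List.reverse_nil, List.nil_append,
          List.cons_append] at e1 e2
        rw [e, cf_step, cf_step, e1, e2]
        split_ifs <;> ring

/-- Case of all outer letters stripped. -/
theorem cf_strip_all {A : Type*} {a b b' : A} (hb : b ≠ a) (hb' : b' ≠ a)
    {P P' P'' : List A} (h1 : P = b :: P') (h2 : P = P'' ++ [b']) (s : List A) (M : ℕ) :
    ∀ i l : ℕ, i + l = M →
    cf (List.replicate i a ++ P ++ List.replicate l a) (List.replicate M a ++ s) =
      (-1) ^ i * (M.choose i : ℤ) * cf P s := by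
  classical
  induction M with
  | zero =>
    intro i l h
    obtain ⟨rfl, rfl⟩ : i = 0 ∧ l = 0 := by omega
    simp
  | succ M ih =>
    intro i l h
    rcases i with _ | i
    · obtain ⟨l, rfl⟩ : ∃ k, l = k + 1 := ⟨M, by omega⟩
      have := ih 0 l (by omega)
      simp only [List.replicate_zero, List.nil_append, h1, List.cons_append] at this ⊢
      rw [List.replicate_succ', ← List.append_assoc, List.replicate_succ, List.cons_append,
        cf_step, if_pos rfl, if_neg hb.symm, this]
      simp
    · rcases l with _ | l
      · have := ih i 0 (by omega)
        simp only [List.replicate_zero, List.append_nil, h2] at this ⊢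
        rw [List.replicate_succ, List.cons_append, ← List.append_assoc, List.replicate_succ,
          List.cons_append, cf_step, if_pos rfl, if_neg hb'.symm, List.append_assoc, this]
        have : i = M := by omega
        subst this
        simp; ring
      · have e1 := ih (i+1) l (by omega)
        have e2 := ih i (l+1) (by omega)
        have : List.replicate (i+1) a ++ P ++ List.replicate (l+1) a =
            a :: ((List.replicate i a ++ P ++ List.replicate l a) ++ [a]) := by
          simp [List.replicate_succ, ← List.replicate_succ', List.append_assoc]
        rw [this, List.replicate_succ, List.cons_append, cf_step, if_pos rfl, if_pos rfl]
        rw [List.replicate_succ, List.cons_append, List.cons_append] at e1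
        rw [List.replicate_succ', ← List.append_assoc] at e2
        rw [e1, e2, Nat.choose_succ_succ]
        push_cast; ring

theorem cf_strip_left {A : Type*} {a b : A} (hb : b ≠ a)
    (P' : List A) (s : List A) (m : ℕ) :
    ∀ d i : ℕ,
    cf (List.replicate i a ++ (b :: P') ++ List.replicate (m + 1 + d) a)
      (List.replicate m a ++ b :: s) =
      (-1) ^ (i + 1) * (m.choose i : ℤ) * cf (P' ++ List.replicate (d + 1 + i) a) s := by
  classical
  induction m with
  | zero =>
    intro d i
    rw [show 0 + 1 + d = d + 1 by omega, List.replicate_succ', ← List.append_assoc]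
    rcases i with _ | i
    · simp only [List.replicate_zero, List.nil_append, List.cons_append]
      rw [cf_step, if_neg hb, if_pos rfl]
      simp [List.replicate_succ']
    · rw [List.replicate_succ]
      simp only [List.replicate_zero, List.nil_append, List.cons_append]
      rw [cf_step, if_neg hb, if_neg hb]
      simp
  | succ m ih =>
    intro d i
    rw [show m + 1 + 1 + d = (m + 1 + d) + 1 by omega, List.replicate_succ', ← List.append_assoc]
    rcases i with _ | i
    · have := ih d 0
      simp only [List.replicate_zero, List.nil_append, List.cons_append] at this ⊢
      rw [List.replicate_succ, List.cons_append, cf_step, if_pos rfl, if_neg hb.symm, this]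
      simp
    · have e1 := ih d (i+1)
      have e2 : cf (List.replicate i a ++ (b :: P') ++ List.replicate (m + 1 + d) a ++ [a])
          (List.replicate m a ++ b :: s) = (-1) ^ (i + 1) * (m.choose i : ℤ) *
            cf (P' ++ List.replicate (d + 1 + (i + 1)) a) s := by
        have := ih (d + 1) i
        rw [show m + 1 + (d + 1) = (m + 1 + d) + 1 by omega, List.replicate_succ' (n := m + 1 + d),
          ← List.append_assoc, show d + 1 + 1 + i = d + 1 + (i + 1) by omega] at this
        exact this
      rw [List.replicate_succ, List.cons_append, List.cons_append] at e1
      rw [List.replicate_succ, List.replicate_succ, List.cons_append, List.cons_append,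
        List.cons_append, List.cons_append, cf_step, if_pos rfl, if_pos rfl, e1, e2,
        Nat.choose_succ_succ]
      push_cast; ring

theorem cf_strip_both {A : Type*} {a b : A} (hb : b ≠ a)
    {P P' P'' : List A} (h1 : P = b :: P') (h2 : P = P'' ++ [b]) (s : List A) (M : ℕ) :
    ∀ i l : ℕ, i + l = M + 1 →
    cf (List.replicate i a ++ P ++ List.replicate l a) (List.replicate M a ++ b :: s) =
      (-1) ^ (i + 1) * ((M.choose i : ℤ) * cf (P' ++ [a]) s
        + (M.choose l : ℤ) * cf (a :: P'') s) := by
  classical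
  induction M with
  | zero =>
    intro i l h
    rcases i with _ | i
    · obtain rfl : l = 1 := by omega
      simp only [List.replicate_zero, List.nil_append, h1, List.cons_append, List.replicate_one]
      rw [cf_step, if_neg hb, if_pos rfl]
      simp
    · obtain ⟨rfl, rfl⟩ : i = 0 ∧ l = 0 := by omega
      simp only [List.replicate_zero, List.nil_append, h2, List.cons_append, List.replicate_one,
        zero_add, List.append_nil]
      rw [cf_step, if_neg hb, if_pos rfl]
      simp
  | succ M ih =>
    intro i l h
    rcases i with _ | i
    · obtain ⟨l, rfl⟩ : ∃ k, l = k + 1 := ⟨M + 1, by omega⟩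
      have := ih 0 l (by omega)
      have hl : M < l := by omega
      have hl2 : M + 1 < l + 1 := by omega
      simp only [List.replicate_zero, List.nil_append] at this ⊢
      rw [h1, List.cons_append] at this ⊢
      rw [List.replicate_succ', ← List.append_assoc, List.replicate_succ (n := M),
        List.cons_append,
        cf_step, if_pos rfl, if_neg hb.symm, this]
      simp [Nat.choose_eq_zero_of_lt hl, Nat.choose_eq_zero_of_lt hl2]
    · rcases l with _ | l
      · have := ih i 0 (by omega)
        have hl : M < i := by omega
        have hl2 : M + 1 < i + 1 := by omega
        simp only [List.replicate_zero, List.append_nil] at this ⊢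
        rw [h2] at this ⊢
        rw [List.replicate_succ, List.cons_append, ← List.append_assoc,
          List.replicate_succ (n := M),
          List.cons_append, cf_step, if_pos rfl, if_neg hb.symm, List.append_assoc,
          this]
        simp [Nat.choose_eq_zero_of_lt hl, Nat.choose_eq_zero_of_lt hl2]; ring
      · have e1 := ih (i+1) l (by omega)
        have e2 := ih i (l+1) (by omega)
        have : List.replicate (i+1) a ++ P ++ List.replicate (l+1) a =
            a :: ((List.replicate i a ++ P ++ List.replicate l a) ++ [a]) := by
          simp [List.replicate_succ, ← List.replicate_succ', List.append_assoc]
        rw [this, List.replicate_succ, List.cons_append, cf_step, if_pos rfl, if_pos rfl]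
        rw [List.replicate_succ, List.cons_append, List.cons_append] at e1
        rw [List.replicate_succ', ← List.append_assoc] at e2
        rw [e1, e2, Nat.choose_succ_succ M i, Nat.choose_succ_succ M l]
        push_cast; ring

theorem decompL {A : Type*} (a : A) (w : List A) : (∃ n, w = List.replicate n a) ∨
    ∃ (i : ℕ) (b : A) (r : List A), b ≠ a ∧ w = List.replicate i a ++ b :: r := by
  induction w with
  | nil => exact Or.inl ⟨0, rfl⟩
  | cons c t ih =>
    by_cases hc : c = a
    · subst hc
      rcases ih with ⟨n, rfl⟩ | ⟨i, b, r, hb, rfl⟩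
      · exact Or.inl ⟨n + 1, rfl⟩
      · exact Or.inr ⟨i + 1, b, r, hb, rfl⟩
    · exact Or.inr ⟨0, c, t, hc, rfl⟩

theorem decompR {A : Type*} (a : A) (w : List A) : (∃ n, w = List.replicate n a) ∨
    ∃ (i : ℕ) (b : A) (r : List A), b ≠ a ∧ w = r ++ [b] ++ List.replicate i a := by
  rcases decompL a w.reverse with ⟨n, h⟩ | ⟨i, b, r, hb, h⟩
  · left; refine ⟨n, ?_⟩
    rw [List.reverse_eq_iff] at h; simpa using h
  · right; refine ⟨i, b, r.reverse, hb, ?_⟩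
    rw [List.reverse_eq_iff] at h; simpa using h

theorem decomp {A : Type*} (a : A) (w : List A) : (∃ n, w = List.replicate n a) ∨
    ∃ (i l : ℕ) (b b' : A) (P P' P'' : List A), b ≠ a ∧ b' ≠ a ∧ P = b :: P' ∧ P = P'' ++ [b'] ∧
      w = List.replicate i a ++ P ++ List.replicate l a := by
  rcases decompL a w with h | ⟨i, b, r, hb, rfl⟩
  · exact Or.inl h
  · right
    rcases decompR a (b :: r) with ⟨n, h⟩ | ⟨l, b', P'', hb', h⟩
    · exact (hb (List.eq_of_mem_replicate (h ▸ List.mem_cons_self))).elim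
    · rw [h]
      cases P'' with
      | nil =>
        simp at h
        exact ⟨i, l, b, b', [b'], [], [], hb, hb', by simp [h.1], by simp, by simp⟩
      | cons x t =>
        simp at h
        exact ⟨i, l, b, b', x :: t ++ [b'], t ++ [b'], x :: t, hb, hb', by simp [h.1], by simp,
          by simp⟩

def Good {A : Type*} (w : List A) : Prop :=
  (∃ (a : A) (n : ℕ), 2 ≤ n ∧ w = List.replicate n a) ∨ (w.reverse = w ∧ Even w.length)

theorem Good.ends {A : Type*} {x y : A} {u : List A} (h : Good (x :: (u ++ [y]))) : x = y := by
  rcases h with ⟨a, n, _, h⟩ | ⟨h, _⟩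
  · have h1 : x = a := List.eq_of_mem_replicate (n := n) (h ▸ by simp)
    have h2 : y = a := List.eq_of_mem_replicate (n := n) (h ▸ by simp)
    rw [h1, h2]
  · simp at h; exact h.1.symm

theorem even_count {A : Type*} [DecidableEq A] (b : A) (w : List A) (h : w.reverse = w)
    (he : Even w.length) : Even (w.count b) := by
  induction w using List.bidirectionalRec with
  | nil => simp
  | singleton a => simp at he
  | cons_append x u y ih =>
    have hxy : y = x := by simp at h; exact h.1
    subst hxy
    have hu : u.reverse = u := by simpa using h
    have he' : Even u.length := by
      simp only [List.length_cons, List.length_append, List.length_nil] at he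
      revert he; simp [parity_simps]
    have := ih hu he'
    simp only [List.count_cons, List.count_append, List.count_nil]
    obtain ⟨k, hk⟩ := this
    rw [hk]
    exact ⟨k + (if (y == b) = true then 1 else 0), by ring⟩

theorem ends_eq {A : Type*} (x y : A) (u : List A)
    (ih : ∀ v : List A, v.length < (x :: (u ++ [y])).length → (∀ s, cf v s = 0) → Good v)
    (h : ∀ s, cf (x :: (u ++ [y])) s = 0) : x = y := by
  classical
  by_contra hxy
  have h1 : Good (x :: u) := ih _ (by simp) (fun s => by
    have := h (y :: s)
    rw [cf_step, if_pos rfl, if_neg (Ne.symm hxy)] at this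
    simpa using this)
  have h2 : Good (u ++ [y]) := ih _ (by simp) (fun s => by
    have := h (x :: s)
    rw [cf_step, if_pos rfl, if_neg hxy] at this
    simpa using this)
  have k1 := h1
  have k2 := h2
  rcases h1 with ⟨a, n, hn, e⟩ | ⟨e1, e2⟩
  · obtain ⟨k, rfl⟩ : ∃ k, n = k + 2 := ⟨n - 2, by omega⟩
    simp only [List.replicate_succ, List.cons.injEq] at e
    obtain ⟨rfl, rfl⟩ := e
    exact hxy k2.ends
  · rcases h2 with ⟨a, n, hn, e⟩ | ⟨e3, e4⟩
    · obtain ⟨k, rfl⟩ : ∃ k, n = k + 2 := ⟨n - 2, by omega⟩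
      rw [List.replicate_succ', List.replicate_succ'] at e
      obtain ⟨e5, e6⟩ := List.append_inj' e rfl
      simp at e6
      subst e6; subst e5
      exact hxy k1.ends
    · have c1 := even_count x _ e1 e2
      have c2 := even_count x _ e3 e4
      simp [List.count_append, Ne.symm hxy] at c1 c2
      rw [Nat.even_add_one] at c1
      exact c1 c2

theorem not_lt_case {A : Type*} {a b : A} (hb : b ≠ a) {P P' P'' : List A} (h1 : P = b :: P')
    (h2 : P = P'' ++ [b]) (hg : Good P) (i l : ℕ) (hil : i < l)
    (ih : ∀ v : List A, v.length < (List.replicate i a ++ P ++ List.replicate l a).length →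
      (∀ s, cf v s = 0) → Good v)
    (h : ∀ s, cf (List.replicate i a ++ P ++ List.replicate l a) s = 0) : False := by
  classical
  obtain ⟨d, rfl⟩ : ∃ d, l = i + 1 + d := ⟨l - (i + 1), by omega⟩
  have hG : Good (P' ++ List.replicate (d + 1 + i) a) := by
    refine ih _ (by simp [h1]; omega) (fun s => ?_)
    have := h (List.replicate i a ++ b :: s)
    rw [h1, cf_strip_left hb] at this
    simpa using this
  have hG' := hG
  have hP' : P' ≠ [] := by
    rintro rfl
    subst h1
    rcases hg with ⟨c, n, hn, e⟩ | ⟨_, e⟩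
    · have := congrArg List.length e
      simp at this; omega
    · simp at e
  obtain ⟨c, Q, rfl⟩ := List.exists_cons_of_ne_nil hP'
  have hca : c = a := by
    rw [show d + 1 + i = (d + i) + 1 by omega, List.replicate_succ', ← List.append_assoc,
      List.cons_append, List.cons_append] at hG
    exact hG.ends
  subst hca
  have hbP : b ∈ Q := by
    rw [h1] at h2
    have hm : P'' ≠ [] := by rintro rfl; simp at h2
    obtain ⟨x, T, rfl⟩ := List.exists_cons_of_ne_nil hm
    simp only [List.cons_append, List.cons.injEq] at h2
    rcases T with _ | ⟨y, T⟩
    · simp at h2; exact (hb h2.2.1.symm).elim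
    · simp at h2; rw [h2.2.2]; simp
  rcases hg with ⟨e, n, hn, he⟩ | ⟨e1, e2⟩
  · have q1 : b = e := List.eq_of_mem_replicate (n := n) (he ▸ by simp [h1])
    have q2 : c = e := List.eq_of_mem_replicate (n := n) (he ▸ by simp [h1])
    exact hb (q1.trans q2.symm)
  · rcases hG' with ⟨e, n, hn, he⟩ | ⟨e3, e4⟩
    · have q1 : b = e := List.eq_of_mem_replicate (n := n) (he ▸ by simp [hbP])
      have q2 : c = e := List.eq_of_mem_replicate (n := n) (he ▸ by simp)
      exact hb (q1.trans q2.symm)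
    · have c1 := even_count b _ e1 e2
      have c2 := even_count b _ e3 e4
      rw [h1, List.count_cons_self, Nat.even_add_one] at c1
      rw [List.count_append, List.count_replicate, if_neg (by simpa using hb.symm), add_zero] at c2
      exact c1 c2

theorem good_of_zero {A : Type*} (w : List A) (h : ∀ s, cf w s = 0) : Good w := by
  classical
  induction hN : w.length using Nat.strong_induction_on generalizing w with
  | _ N IH =>
  have ih : ∀ v : List A, v.length < w.length → (∀ s, cf v s = 0) → Good v :=
    fun v hv hz => IH v.length (hN ▸ hv) v hz rfl
  clear IH
  rcases List.eq_nil_or_concat w with rfl | ⟨t, y, rfl⟩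
  · right; simp
  rcases t with _ | ⟨a, u⟩
  · have := h [y]
    rw [List.concat_eq_append, List.nil_append, cf_single] at this
    simp at this
  simp only [List.concat_eq_append, List.cons_append] at h hN ih ⊢
  obtain rfl := ends_eq a y u ih h
  rcases decomp a (a :: (u ++ [a])) with ⟨n, e⟩ | ⟨i, l, b, b', P, P', P'', hb, hb', h1, h2, e⟩
  · left
    refine ⟨a, n, ?_, e⟩
    have := congrArg List.length e
    simp at this; omega
  rw [e] at h ih ⊢
  clear hN
  have hi : 1 ≤ i := by
    by_contra hi
    obtain rfl : i = 0 := by omega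
    simp [h1] at e
    exact hb e.1.symm
  have hPlt : P.length < (List.replicate i a ++ P ++ List.replicate l a).length := by
    simp; omega
  have hP : ∀ s, cf P s = 0 := by
    intro s
    have := h (List.replicate (i + l) a ++ s)
    rw [cf_strip_all hb hb' h1 h2 s (i + l) i l rfl] at this
    have hc : (i + l).choose i ≠ 0 := by
      exact (Nat.choose_pos (by omega)).ne'
    simpa [hc] using this
  have hg : Good P := ih P hPlt hP
  have hbb : b' = b := by
    rcases P' with _ | ⟨x, T⟩
    · rw [h1] at h2
      rcases P'' with _ | ⟨z, Z⟩
      · simp at h2; exact h2.symm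
      · simp at h2
    · rcases P'' with _ | ⟨z, Z⟩
      · rw [h1] at h2; simp at h2
      · have : b = z := by rw [h1] at h2; simp at h2; exact h2.1
        subst this
        rw [h2] at hg
        exact hg.ends.symm
  subst hbb
  rcases lt_trichotomy i l with hil | rfl | hil
  · exact (not_lt_case hb h1 h2 hg i l hil ih h).elim
  · by_cases hpal : P.reverse = P ∧ Even P.length
    · right
      refine ⟨by simp [hpal.1], ?_⟩
      obtain ⟨k, hk⟩ := hpal.2
      exact ⟨k + i, by simp [hk]; ring⟩
    · exfalso
      rcases hg with ⟨c, n, hn, e'⟩ | hg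
      · have hc : b' = c := List.eq_of_mem_replicate (n := n) (e' ▸ by simp [h1])
        subst hc
        obtain ⟨k, rfl⟩ : ∃ k, n = k + 1 := ⟨n - 1, by omega⟩
        have hk : Even k := by
          by_contra hk
          apply hpal
          rw [e']
          refine ⟨by simp, ?_⟩
          rw [List.length_replicate, Nat.even_add_one]; exact hk
        have q1 : P = b' :: List.replicate k b' := by rw [e', List.replicate_succ]
        have q2 : P = List.replicate k b' ++ [b'] := by rw [e', List.replicate_succ']
        have hZ : ∀ s, cf (a :: List.replicate k b') s = 0 := by
          intro s
          obtain ⟨j, rfl⟩ : ∃ j, i = j + 1 := ⟨i - 1, by omega⟩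
          have := h (List.replicate (2 * j + 1) a ++ b' :: s)
          rw [cf_strip_both hb q1 q2 s (2 * j + 1) (j + 1) (j + 1) (by ring)] at this
          have hr := cf_reverse (a :: List.replicate k b') s
          simp only [List.reverse_cons, List.reverse_replicate, List.length_cons,
            List.length_replicate] at hr
          rw [Even.neg_one_pow (by simpa [parity_simps] using hk), one_mul] at hr
          rw [hr, ← mul_add, ← two_mul] at this
          have hc : (2 * j + 1).choose (j + 1) ≠ 0 := by
            exact (Nat.choose_pos (by omega)).ne'
          simpa [hc] using this
        have hgood := ih _ (by simp [q1]; omega) hZ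
        obtain ⟨k, rfl⟩ : ∃ m, k = m + 1 := ⟨k - 1, by omega⟩
        rw [List.replicate_succ'] at hgood
        exact hb hgood.ends.symm
      · exact hpal hg
  · exfalso
    refine not_lt_case (P := P.reverse) (P' := P''.reverse) (P'' := P'.reverse) hb
      (by rw [h2]; simp) (by rw [h1]; simp) ?_ l i hil ?_ ?_
    · rcases hg with ⟨c, n, hn, e'⟩ | hg
      · left; exact ⟨c, n, hn, by rw [e']; simp⟩
      · right; simpa [eq_comm] using hg
    · intro v hv
      apply ih
      simp at hv ⊢; omega
    · intro s
      have := cf_reverse (List.replicate i a ++ P ++ List.replicate l a) s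
      rw [h s, mul_zero] at this
      simpa [List.append_assoc] using this

theorem zero_of_good {A : Type*} (w : List A) (h : Good w) (s : List A) : cf w s = 0 := by
  classical
  rcases h with ⟨a, n, hn, rfl⟩ | ⟨h1, h2⟩
  · obtain ⟨k, rfl⟩ : ∃ k, n = k + 2 := ⟨n - 2, by omega⟩
    cases s with
    | nil => exact cf_right_nil _
    | cons c s =>
      rw [List.replicate_succ, List.replicate_succ', cf_step, ← List.replicate_succ',
        ← List.replicate_succ, sub_self]
  · have := cf_reverse w s
    rw [h1, Odd.neg_one_pow h2.add_one] at this
    linarith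

/-- over the free Lie ring, `l*(w) = 0` iff `w` is a power `a^n` of a
single letter with `n ≥ 2`, or a palindrome of even length. -/
theorem lstar_int_eq_zero_iff {A : Type*} [Fintype A] (w : List A) :
    lstar ℤ w = 0 ↔
      (∃ (a : A) (n : ℕ), 2 ≤ n ∧ w = List.replicate n a) ∨
        (w.reverse = w ∧ Even w.length) := by
  rw [lstar_eq_zero_iff_cf]
  exact ⟨good_of_zero w, zero_of_good w⟩
end
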